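/- arXiv:1905.09223 — 2 statements merged into one kernel-verified Lean document; each statement's English description precedes it below -/
import Mathlib

section
/- Let α be a real number with α − max G ∉ {0, −1, −2, …} and assume Ω_G(n) ≠ 0 for every integer n ≥ 0. Then for every nonzero real polynomial p, setting s = deg p + max G + 1, there exist real numbers γ_{n,j} (n ≥ 0, −s ≤ j ≤ s) such that x^{max G + 1}·p(x)·q_n(x) = Σ_{j=−s}^{s} γ_{n,j}·q_{n+j}(x) for every n ≥ 0 (with the convention q_k = 0 for k < 0), where γ_{n,s} ≠ 0 for every n ≥ 0 and γ_{n,−s} ≠ 0 for every n ≥ s. -/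
open Polynomial Finset

/-- Pochhammer symbol `(a)_l = a (a+1) ⋯ (a+l-1)`, with `(a)_0 = 1`. -/
noncomputable def poch (a : ℝ) (l : ℕ) : ℝ := ∏ t ∈ Finset.range l, (a + t)

/-- Generalized binomial coefficient `binom (n+α, n−j) = (α+j+1)⋯(α+n)/(n−j)!`. -/
noncomputable def genBinom (α : ℝ) (n j : ℕ) : ℝ :=
  (∏ t ∈ Finset.Ico (j + 1) (n + 1), (α + t)) / (Nat.factorial (n - j) : ℝ)

/-- Laguerre polynomial `L_n^α(x) = Σ_{j=0}^n ((−x)^j/j!)·binom(n+α, n−j)`. -/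
noncomputable def laguerre (α : ℝ) (n : ℕ) : Polynomial ℝ :=
  ∑ j ∈ Finset.range (n + 1),
    Polynomial.C ((-1 : ℝ) ^ j / (Nat.factorial j : ℝ) * genBinom α n j) * Polynomial.X ^ j

/-- Laguerre polynomials indexed by `ℤ`, with the convention `L_u^α = 0` for `u < 0`. -/
noncomputable def laguerreZ (α : ℝ) (n : ℤ) : Polynomial ℝ :=
  if n < 0 then 0 else laguerre α n.toNat

/-- The polynomial `binom (x+l, l) = (x+1)(x+2)⋯(x+l)/l!`. -/
noncomputable def binomPoly (l : ℕ) : Polynomial ℝ :=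
  Polynomial.C ((Nat.factorial l : ℝ)⁻¹) *
    ∏ t ∈ Finset.range l, (Polynomial.X + Polynomial.C ((t : ℝ) + 1))

/-- The Casoratian `Ω_G(x) = det (R_{g_l}(x−j))_{l,j=1,…,m}`. -/
noncomputable def casoratian {m : ℕ} (R : Fin m → Polynomial ℝ) (x : ℝ) : ℝ :=
  Matrix.det (Matrix.of fun l j : Fin m => (R l).eval (x - ((j : ℕ) + 1)))

/-- The maximum of the finite set `G` (given by the values of `g`). -/
noncomputable def Gmax {m : ℕ} (g : Fin m → ℕ) : ℕ := Finset.univ.sup g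

/-- The polynomial `q_n`, defined as an `(m+1)×(m+1)` determinant whose first row is
`(L_n^α(x), …, L_{n−m}^α(x))` and whose `(h+1)`-th row is `(R_{g_h}(n), …, R_{g_h}(n−m))`. -/
noncomputable def qpoly (α : ℝ) {m : ℕ} (R : Fin m → Polynomial ℝ) (n : ℤ) : Polynomial ℝ :=
  Matrix.det (Matrix.of fun i j : Fin (m + 1) =>
    if h : (i : ℕ) = 0 then laguerreZ α (n - (j : ℕ))
    else Polynomial.C ((R ⟨(i : ℕ) - 1, by have := i.isLt; omega⟩).eval ((n : ℝ) - ((j : ℕ) : ℝ))))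

/-- `q_n` extended by the convention `q_k = 0` for `k < 0`. -/
noncomputable def qZ (α : ℝ) {m : ℕ} (R : Fin m → Polynomial ℝ) (n : ℤ) : Polynomial ℝ :=
  if n < 0 then 0 else qpoly α R n

/-- `momFun β p k = L_β(p(x)·x^k)`, where `L_β` is the moment functional on Laurent
polynomials determined by `L_β(x^j) = Γ(β+j+1)`. -/
noncomputable def momFun (β : ℝ) (p : Polynomial ℝ) (k : ℤ) : ℝ :=
  ∑ t ∈ Finset.range (p.natDegree + 1), p.coeff t * Real.Gamma (β + t + k + 1)

/-- The bilinear form `⟨p, q⟩ = L_{α−m}(p·q) + Σ_{i=0}^{m−1} (q^{(i)}(0)/i!)·L_α(p·U_i)`,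
where `U_i(x) = Σ_{g∈G} ( −x^{i−m}/m + κ_i^g·Σ_{l=0}^g (α−l)_l w_l^g x^{−l−1} )`. -/
noncomputable def bilin (α : ℝ) {m : ℕ} (g : Fin m → ℕ) (κ : ℕ → Fin m → ℝ)
    (w : Fin m → ℕ → ℝ) (p q : Polynomial ℝ) : ℝ :=
  momFun (α - m) (p * q) 0 +
    ∑ i ∈ Finset.range m,
      (Polynomial.eval 0 (Polynomial.derivative^[i] q) / (Nat.factorial i : ℝ)) *
        (∑ h : Fin m,
          (-(1 / (m : ℝ)) * momFun α p ((i : ℤ) - (m : ℤ)) +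
            κ i h * ∑ l ∈ Finset.range (g h + 1),
              poch (α - l) l * w h l * momFun α p (-((l : ℤ) + 1))))

/-- The bilinear form `⟨p, q⟩_ξ` (case `α` a positive integer with `α ≤ max G`). -/
noncomputable def bilinXi (α : ℕ) {m : ℕ} (g : Fin m → ℕ) (κ : ℕ → Fin m → ℝ)
    (w : Fin m → ℕ → ℝ) (p q : Polynomial ℝ) : ℝ :=
  momFun ((α - m : ℕ) : ℝ) (p * Polynomial.derivative^[m - α] q) 0 +
    ∑ i ∈ Finset.range m,
      (Polynomial.eval 0 (Polynomial.derivative^[i] q) / (Nat.factorial i : ℝ)) *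
        (∑ h : Fin m,
          (poch ((i : ℝ) - m + α + 1) (m - α) * (-(1 / (m : ℝ))) * momFun α p ((i : ℤ) - (m : ℤ)) +
            κ i h * ∑ l ∈ Finset.range (if g h < α then g h + 1 else α),
              poch ((α : ℝ) - l) l * w h l * momFun α p (-((l : ℤ) + 1)))) +
    Real.Gamma α *
      ∑ i ∈ Finset.range m,
        (Polynomial.eval 0 (Polynomial.derivative^[i] q) / (Nat.factorial i : ℝ)) *
          ∑ h ∈ Finset.univ.filter (fun h : Fin m => α ≤ g h),
            κ i h *
              ∑ j ∈ Finset.range (g h - α + 1),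
                (Polynomial.eval 0 (Polynomial.derivative^[j] p) / (Nat.factorial j : ℝ)) *
                  ∑ l ∈ Finset.Icc (α + j) (g h), poch ((α : ℝ) - l) j * w h l

/-! ### Coefficients and the three term recurrence of Laguerre polynomials -/

theorem laguerre_coeff (α : ℝ) (n j : ℕ) :
    (laguerre α n).coeff j =
      if j ≤ n then (-1 : ℝ) ^ j / (Nat.factorial j : ℝ) * genBinom α n j else 0 := by
  unfold laguerre
  simp only [finsetSum_coeff, coeff_C_mul, coeff_X_pow]
  simp [Nat.lt_succ_iff]

theorem genBinom_add (α : ℝ) (j d : ℕ) :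
    genBinom α (j + d) j = (∏ t ∈ Finset.range d, (α + (j + 1 + t : ℕ))) / (Nat.factorial d : ℝ) := by
  unfold genBinom
  rw [Finset.prod_Ico_eq_prod_range]
  have h1 : j + d + 1 - (j + 1) = d := by omega
  have h2 : j + d - j = d := by omega
  rw [h1, h2]

theorem laguerre_rec (α : ℝ) (n : ℕ) :
    X * laguerre α (n + 1) = C (-((n : ℝ) + 2)) * laguerre α (n + 2)
      + C (2 * ((n : ℝ) + 1) + α + 1) * laguerre α (n + 1)
      + C (-((n : ℝ) + 1 + α)) * laguerre α n := by
  ext j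
  simp only [coeff_add, coeff_C_mul, laguerre_coeff]
  rcases j with _ | j
  · simp only [coeff_X_mul_zero]
    have e0 := genBinom_add α 0 n
    have e1 := genBinom_add α 0 (n + 1)
    have e2 := genBinom_add α 0 (n + 2)
    simp only [Nat.zero_add] at e0 e1 e2
    rw [e0, e1, e2]
    simp only [Finset.prod_range_succ, Nat.factorial_succ]
    have : (n.factorial : ℝ) ≠ 0 := by positivity
    have h1 : (n : ℝ) + 1 ≠ 0 := by positivity
    have h2 : (n : ℝ) + 1 + 1 ≠ 0 := by positivity
    simp
    field_simp
    ring
  · simp only [coeff_X_mul, laguerre_coeff]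
    rcases Nat.lt_or_ge n (j + 1) with h | h
    · rcases Nat.lt_or_ge (n + 1) (j + 1) with h' | h'
      · rcases Nat.lt_or_ge (n + 2) (j + 1) with h'' | h''
        · rw [if_neg (by omega), if_neg (by omega), if_neg (by omega), if_neg (by omega)]; simp
        · obtain rfl : j = n + 1 := by omega
          have e1 := genBinom_add α (n + 1) 0
          have e2 := genBinom_add α (n + 2) 0
          simp only [Nat.add_zero] at e1 e2
          rw [if_pos (by omega), if_pos (by omega), if_neg (by omega), if_neg (by omega), e1, e2]
          simp only [Nat.factorial_succ]
          have : (n.factorial : ℝ) ≠ 0 := by positivity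
          have h1 : (n : ℝ) + 1 ≠ 0 := by positivity
          have h2 : (n : ℝ) + 1 + 1 ≠ 0 := by positivity
          push_cast
          simp
          field_simp
          ring
      · obtain rfl : j = n := by omega
        have e0 := genBinom_add α j 1
        have e1 := genBinom_add α (j + 1) 0
        have e2 := genBinom_add α (j + 1) 1
        simp only [Nat.add_zero] at e1
        rw [if_pos (by omega), if_pos (by omega), if_pos (by omega), if_neg (by omega), e0, e1,
          show j + 2 = j + 1 + 1 from rfl, e2]
        simp only [Nat.factorial_succ]
        have : (j.factorial : ℝ) ≠ 0 := by positivity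
        have h1 : (j : ℝ) + 1 ≠ 0 := by positivity
        push_cast
        simp
        field_simp
        ring
    · obtain ⟨d, rfl⟩ := Nat.exists_eq_add_of_le h
      have e0 := genBinom_add α j (d + 2)
      have e1 := genBinom_add α (j + 1) d
      have e2 := genBinom_add α (j + 1) (d + 1)
      have e3 := genBinom_add α (j + 1) (d + 2)
      rw [if_pos (by omega), if_pos (by omega), if_pos (by omega), if_pos (by omega), 
        show j + 1 + d + 1 = j + 1 + (d + 1) by omega,
        show j + 1 + d + 2 = j + 1 + (d + 2) by omega, e1, e2, e3,
        show j + 1 + (d + 1) = j + (d + 2) by omega, e0]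
      rw [Finset.prod_range_succ' _ (d + 1)]
      simp only [Finset.prod_range_succ, Nat.factorial_succ]
      have e4 : ∀ t : ℕ, (α + ((j + 1 + (t + 1) : ℕ) : ℝ)) = α + ((j + 1 + 1 + t : ℕ) : ℝ) := by
        intro t; congr 2; omega
      simp only [e4]
      generalize (∏ x ∈ Finset.range d, (α + ((j + 1 + 1 + x : ℕ) : ℝ))) = B
      have : (j.factorial : ℝ) ≠ 0 := by positivity
      have h0 : (d.factorial : ℝ) ≠ 0 := by positivity
      have h1 : (j : ℝ) + 1 ≠ 0 := by positivity
      have h2 : (d : ℝ) + 1 ≠ 0 := by positivity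
      have h3 : (d : ℝ) + 1 + 1 ≠ 0 := by positivity
      push_cast
      field_simp
      ring

theorem laguerreZ_rec (α : ℝ) (k : ℤ) :
    X * laguerreZ α k = C (-((k : ℝ) + 1)) * laguerreZ α (k + 1)
      + C (2 * (k : ℝ) + α + 1) * laguerreZ α k
      + C (-((k : ℝ) + α)) * laguerreZ α (k - 1) := by
  rcases lt_or_ge k 0 with h | h
  · rcases eq_or_ne k (-1) with rfl | h1
    · simp [laguerreZ]
    · have h2 : k + 1 < 0 := by omega
      have h3 : k - 1 < 0 := by omega
      simp [laguerreZ, h, h2, h3]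
  · obtain ⟨n, rfl⟩ := Int.eq_ofNat_of_zero_le h
    rcases n with _ | n
    · have hL0 : laguerre α 0 = 1 := by simp [laguerre, genBinom]
      have hL1 : laguerre α 1 = C α + 1 - X := by
        simp [laguerre, genBinom, Finset.sum_range_succ]; ring
      simp [laguerreZ, hL0, hL1]
    · have a1 : ¬ (((n + 1 : ℕ) : ℤ) < 0) := by omega
      have a2 : ¬ (((n + 1 : ℕ) : ℤ) + 1 < 0) := by omega
      have a3 : ¬ (((n + 1 : ℕ) : ℤ) - 1 < 0) := by omega
      have b1 : ((n + 1 : ℕ) : ℤ).toNat = n + 1 := by omega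
      have b2 : (((n + 1 : ℕ) : ℤ) + 1).toNat = n + 2 := by omega
      have b3 : (((n + 1 : ℕ) : ℤ) - 1).toNat = n := by omega
      simp only [laguerreZ, if_neg a1, if_neg a2, if_neg a3, b1, b2, b3]
      rw [laguerre_rec]
      push_cast
      ring_nf

/-! ### The formal lift -/

/-- Lift of the multiplication by `x` to formal combinations of `e_k`, `k ∈ ℤ`. -/
noncomputable def Xhat (α : ℝ) : (ℤ →₀ ℝ) →ₗ[ℝ] (ℤ →₀ ℝ) :=
  Finsupp.linearCombination ℝ (fun k : ℤ =>
    Finsupp.single (k + 1) (-((k : ℝ) + 1)) + Finsupp.single k (2 * (k : ℝ) + α + 1)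
      + Finsupp.single (k - 1) (-((k : ℝ) + α)))

/-- The projection `e_k ↦ L_k`. -/
noncomputable def piL (α : ℝ) : (ℤ →₀ ℝ) →ₗ[ℝ] ℝ[X] :=
  Finsupp.linearCombination ℝ (laguerreZ α)

/-- The functional `e_k ↦ R(k)`. -/
noncomputable def phiF (R : ℝ[X]) : (ℤ →₀ ℝ) →ₗ[ℝ] ℝ :=
  Finsupp.linearCombination ℝ (fun k : ℤ => R.eval (k : ℝ))

theorem Xhat_apply (α : ℝ) (f : ℤ →₀ ℝ) (k : ℤ) :
    Xhat α f k = -(k : ℝ) * f (k - 1) + (2 * (k : ℝ) + α + 1) * f k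
      + -((k : ℝ) + 1 + α) * f (k + 1) := by
  induction f using Finsupp.induction_linear with
  | zero => simp
  | add f g hf hg => rw [map_add, Finsupp.add_apply, hf, hg]; simp only [Finsupp.add_apply]; ring
  | single l c =>
    simp only [Xhat, Finsupp.linearCombination_single, Finsupp.smul_apply, Finsupp.add_apply,
      smul_eq_mul, Finsupp.single_apply]
    by_cases h1 : l + 1 = k
    · subst h1
      simp [show ¬ (l - 1 = l + 1) by omega, show ¬ (l = l + 1 + 1) by omega]; ring
    · by_cases h2 : l = k
      · subst h2
        simp [show ¬ (l = l - 1) by omega]; ring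
      · by_cases h3 : l - 1 = k
        · subst h3
          simp [show ¬ (l = l - 1) by omega, show ¬ (l + 1 = l - 1) by omega,
            show ¬ (l = l - 1 - 1) by omega]; ring
        · have h1' : ¬ l = k - 1 := by omega
          have h3' : ¬ l = k + 1 := by omega
          simp [h1, h2, h3, h1', h3']

theorem piL_Xhat (α : ℝ) (f : ℤ →₀ ℝ) : piL α (Xhat α f) = X * piL α f := by
  induction f using Finsupp.induction_linear with
  | zero => simp
  | add f g hf hg => simp only [map_add, hf, hg]; ring
  | single l c =>
    simp only [Xhat, piL, Finsupp.linearCombination_single, map_smul, map_add]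
    rw [mul_smul_comm, laguerreZ_rec]
    simp only [smul_eq_C_mul]

theorem piL_aeval (α : ℝ) (P : ℝ[X]) (f : ℤ →₀ ℝ) :
    piL α (aeval (Xhat α) P f) = P * piL α f := by
  induction P using Polynomial.induction_on with
  | C a => simp [smul_eq_C_mul]
  | add p q hp hq => simp only [map_add, LinearMap.add_apply, hp, hq]; ring
  | monomial n a h =>
    have : C a * X ^ (n + 1) = X * (C a * X ^ n) := by ring
    rw [this, map_mul, aeval_X, Module.End.mul_apply, piL_Xhat, h]; ring

/-- Difference operator. -/
noncomputable def dif (c : ℝ) (R : ℝ[X]) : ℝ[X] := taylor c R - R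

theorem dif_degree (c : ℝ) (R : ℝ[X]) (n : ℕ) (h : R.degree ≤ n) : (dif c R).degree < n := by
  rcases eq_or_ne R 0 with rfl | hR
  · simp [dif]
  · refine lt_of_lt_of_le ?_ h
    have h1 : (taylor c R).degree = R.degree := degree_taylor R c
    have := degree_sub_lt h1 (by intro h0; rw [h0] at h1; exact hR (degree_eq_bot.mp h1.symm))
      (by simp)
    rw [h1] at this
    exact this

theorem degree_le_aux (R : ℝ[X]) (n : ℕ) (h : R.degree < (n + 1 : ℕ)) : R.degree ≤ n := by
  rcases eq_or_ne R 0 with rfl | hR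
  · simp
  · rw [degree_eq_natDegree hR] at h ⊢
    have := Nat.cast_lt.mp h
    exact Nat.cast_le.mpr (by omega)

/-- The transpose of `Xhat`. -/
noncomputable def Aop (α : ℝ) (R : ℝ[X]) : ℝ[X] :=
  X * dif 1 (dif (-1) R) - dif 1 R - C α * dif (-1) R

theorem Aop_degree (α : ℝ) (R : ℝ[X]) (n : ℕ) (h : R.degree < (n + 1 : ℕ)) :
    (Aop α R).degree < n := by
  have h' : R.degree ≤ n := degree_le_aux R n h
  unfold Aop
  have h1 := dif_degree 1 R n h'
  have h2 := dif_degree (-1) R n h'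
  refine (degree_sub_le _ _).trans_lt (max_lt ((degree_sub_le _ _).trans_lt (max_lt ?_ h1)) ?_)
  · rcases n with _ | k
    · have : dif (-1) R = 0 := by
        by_contra h0
        rw [degree_eq_natDegree h0] at h2
        exact absurd (Nat.cast_lt.mp h2) (by omega)
      rw [this]; simp [dif]
    · have h3 : (dif (-1) R).degree ≤ k := degree_le_aux _ k h2
      have h4 := dif_degree 1 _ k h3
      by_cases h0 : dif 1 (dif (-1) R) = 0
      · simp [h0]
      · rw [degree_mul, degree_X, degree_eq_natDegree h0] 
        rw [degree_eq_natDegree h0] at h4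
        have := Nat.cast_lt.mp h4
        rw [← Nat.cast_one, ← Nat.cast_add]
        exact Nat.cast_lt.mpr (by omega)
  · rw [← smul_eq_C_mul]
    exact (degree_smul_le _ _).trans_lt h2

theorem phi_Xhat (α : ℝ) (R : ℝ[X]) (f : ℤ →₀ ℝ) : phiF R (Xhat α f) = phiF (Aop α R) f := by
  induction f using Finsupp.induction_linear with
  | zero => simp
  | add f g hf hg => simp only [map_add, hf, hg]
  | single l c =>
    simp only [Xhat, phiF, Finsupp.linearCombination_single, map_smul, map_add, smul_eq_mul]
    simp only [Aop, dif, eval_sub, eval_mul, eval_X, eval_C, taylor_eval, map_sub]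
    push_cast
    rw [show (l : ℝ) + 1 + -1 = l by ring, show (l : ℝ) + -1 = l - 1 by ring]
    ring

theorem phi_Xhat_pow (α : ℝ) (n : ℕ) : ∀ (R : ℝ[X]) (_ : R.degree < n) (f : ℤ →₀ ℝ),
    phiF R ((Xhat α ^ n) f) = 0 := by
  induction n with
  | zero =>
    intro R h f
    have : R = 0 := by
      by_contra h0
      rw [degree_eq_natDegree h0] at h
      exact absurd (Nat.cast_lt.mp h) (by omega)
    subst this
    simp [phiF, Finsupp.linearCombination_apply]
  | succ n ih =>
    intro R h f
    rw [pow_succ', Module.End.mul_apply, phi_Xhat]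
    exact ih _ (Aop_degree α R n h) f

/-! ### Supports -/

theorem Xhat_pow_supp (α : ℝ) (f : ℤ →₀ ℝ) (a b : ℤ) (hf : ∀ k, k < a ∨ b < k → f k = 0) (d : ℕ) :
    (∀ k, k < a - d ∨ b + d < k → (Xhat α ^ d) f k = 0) ∧
    (0 ≤ b → f b ≠ 0 → (Xhat α ^ d) f (b + d) ≠ 0) ∧
    ((∀ i : ℕ, i < d → (a : ℝ) - i + α ≠ 0) → f a ≠ 0 → (Xhat α ^ d) f (a - d) ≠ 0) := by
  induction d with
  | zero => simpa using hf
  | succ d ih =>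
    obtain ⟨h1, h2, h3⟩ := ih
    rw [pow_succ']
    simp only [Module.End.mul_apply, Xhat_apply]
    refine ⟨?_, ?_, ?_⟩
    · intro k hk
      rw [h1 _ (by push_cast at hk; omega), h1 _ (by push_cast at hk; omega),
        h1 _ (by push_cast at hk; omega)]
      simp
    · intro hb hfb
      rw [h1 (b + (d + 1 : ℕ)) (by push_cast; omega), h1 (b + (d + 1 : ℕ) + 1) (by push_cast; omega)]
      have e : b + ((d + 1 : ℕ) : ℤ) - 1 = b + d := by push_cast; ring
      rw [e]
      have := h2 hb hfb
      have hb' : ((b + ((d + 1 : ℕ) : ℤ) : ℤ) : ℝ) ≠ 0 := by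
        exact_mod_cast (by omega : b + ((d + 1 : ℕ) : ℤ) ≠ 0)
      simp only [mul_zero, add_zero]
      exact mul_ne_zero (neg_ne_zero.mpr hb') this
    · intro hi hfa
      rw [h1 (a - (d + 1 : ℕ)) (by push_cast; omega), h1 (a - (d + 1 : ℕ) - 1) (by push_cast; omega)]
      have e : a - ((d + 1 : ℕ) : ℤ) + 1 = a - d := by push_cast; ring
      rw [e]
      have := h3 (fun i hi' => hi i (by omega)) hfa
      have h4 := hi d (by omega)
      simp only [mul_zero, zero_add]
      refine mul_ne_zero (neg_ne_zero.mpr ?_) this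
      push_cast
      convert h4 using 1
      ring

theorem aeval_supp (α : ℝ) (f : ℤ →₀ ℝ) (a b : ℤ) (hf : ∀ k, k < a ∨ b < k → f k = 0)
    (P : ℝ[X]) (hP : P ≠ 0) :
    (∀ k, k < a - P.natDegree ∨ b + P.natDegree < k → aeval (Xhat α) P f k = 0) ∧
    (0 ≤ b → f b ≠ 0 → aeval (Xhat α) P f (b + P.natDegree) ≠ 0) ∧
    ((∀ i : ℕ, i < P.natDegree → (a : ℝ) - i + α ≠ 0) → f a ≠ 0 →
      aeval (Xhat α) P f (a - P.natDegree) ≠ 0) := by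
  have key : ∀ k, aeval (Xhat α) P f k =
      ∑ i ∈ Finset.range (P.natDegree + 1), P.coeff i * (Xhat α ^ i) f k := by
    intro k
    rw [aeval_eq_sum_range]
    simp [LinearMap.sum_apply, Finsupp.finsetSum_apply]
  have hl : P.coeff P.natDegree ≠ 0 := by simpa using hP
  refine ⟨?_, ?_, ?_⟩
  · intro k hk
    rw [key]
    refine Finset.sum_eq_zero fun i hi => ?_
    rw [Finset.mem_range] at hi
    rw [(Xhat_pow_supp α f a b hf i).1 k (by omega), mul_zero]
  · intro hb hfb
    rw [key, Finset.sum_range_succ, Finset.sum_eq_zero, zero_add]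
    · exact mul_ne_zero hl ((Xhat_pow_supp α f a b hf _).2.1 hb hfb)
    · intro i hi
      rw [Finset.mem_range] at hi
      rw [(Xhat_pow_supp α f a b hf i).1 _ (by omega), mul_zero]
  · intro hi hfa
    rw [key, Finset.sum_range_succ, Finset.sum_eq_zero, zero_add]
    · exact mul_ne_zero hl ((Xhat_pow_supp α f a b hf _).2.2 hi hfa)
    · intro i hi
      rw [Finset.mem_range] at hi
      rw [(Xhat_pow_supp α f a b hf i).1 _ (by omega), mul_zero]

/-! ### The lift of `q_n` -/

/-- Coefficients of `q_n` with respect to `L_{n-j}`. -/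
noncomputable def betaC {m : ℕ} (R : Fin m → ℝ[X]) (n : ℤ) (j : Fin (m + 1)) : ℝ :=
  (-1) ^ (j : ℕ) *
    Matrix.det (Matrix.of fun h i : Fin m => (R h).eval ((n : ℝ) - ((j.succAbove i : ℕ) : ℝ)))

/-- Formal lift of `q_n`. -/
noncomputable def qhat {m : ℕ} (R : Fin m → ℝ[X]) (n : ℤ) : ℤ →₀ ℝ :=
  ∑ j : Fin (m + 1), Finsupp.single (n - (j : ℕ)) (betaC R n j)

theorem piL_qhat (α : ℝ) {m : ℕ} (R : Fin m → ℝ[X]) (n : ℤ) :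
    piL α (qhat R n) = qpoly α R n := by
  unfold qhat qpoly
  rw [Matrix.det_succ_row_zero, map_sum]
  refine Finset.sum_congr rfl fun j _ => ?_
  simp only [piL, Finsupp.linearCombination_single, betaC, smul_eq_C_mul, C_mul, C_pow, C_neg, C_1]
  rw [RingHom.map_det]
  simp only [Matrix.of_apply, Fin.val_zero, dif_pos]
  rw [mul_right_comm]
  congr 2

theorem phi_qhat {m : ℕ} (R : Fin m → ℝ[X]) (n : ℤ) (h : Fin m) :
    phiF (R h) (qhat R n) = 0 := by
  have hz : Matrix.det (Matrix.of fun i j : Fin (m + 1) =>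
      (R (Fin.cons (α := fun _ => Fin m) h id i)).eval ((n : ℝ) - ((j : ℕ) : ℝ))) = 0 := by
    refine Matrix.det_zero_of_row_eq (i := 0) (j := h.succ) (Fin.succ_ne_zero h).symm ?_
    ext j; simp
  rw [← hz, Matrix.det_succ_row_zero, qhat, map_sum]
  refine Finset.sum_congr rfl fun j _ => ?_
  simp only [phiF, Finsupp.linearCombination_single, betaC, smul_eq_mul, Matrix.of_apply,
    Fin.cons_zero]
  rw [mul_right_comm]
  push_cast
  rfl

theorem qhat_apply {m : ℕ} (R : Fin m → ℝ[X]) (n : ℤ) (j : Fin (m + 1)) :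
    qhat R n (n - (j : ℕ)) = betaC R n j := by
  unfold qhat
  rw [Finsupp.finsetSum_apply, Finset.sum_eq_single j]
  · simp
  · intro i _ hi
    rw [Finsupp.single_apply, if_neg]
    intro h
    exact hi (Fin.ext (by omega))
  · simp

theorem qhat_supp {m : ℕ} (R : Fin m → ℝ[X]) (n : ℤ) (k : ℤ) (hk : k < n - m ∨ n < k) :
    qhat R n k = 0 := by
  unfold qhat
  rw [Finsupp.finsetSum_apply]
  refine Finset.sum_eq_zero fun i _ => ?_
  rw [Finsupp.single_apply, if_neg]
  have := i.isLt
  omega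

theorem qhat_top {m : ℕ} (R : Fin m → ℝ[X]) (n : ℤ) :
    qhat R n n = casoratian R n := by
  have := qhat_apply R n 0
  simp only [Fin.val_zero, Nat.cast_zero, sub_zero] at this
  rw [this, betaC, casoratian]
  simp

theorem qhat_bot {m : ℕ} (R : Fin m → ℝ[X]) (n : ℤ) :
    qhat R n (n - m) = (-1) ^ m * casoratian R ((n : ℝ) + 1) := by
  have := qhat_apply R n (Fin.last m)
  simp only [Fin.val_last] at this
  rw [this, betaC, casoratian]
  simp

theorem remainder_zero {m : ℕ} (R : Fin m → ℝ[X]) (N : ℤ) (hN : casoratian R (N : ℝ) ≠ 0)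
    (r : ℤ →₀ ℝ) (hr : ∀ k, k < N - m ∨ N ≤ k → r k = 0) (hphi : ∀ h, phiF (R h) r = 0) :
    r = 0 := by
  have hrep : r = ∑ j : Fin m, Finsupp.single (N - ((j : ℕ) + 1)) (r (N - ((j : ℕ) + 1))) := by
    ext k
    rw [Finsupp.finsetSum_apply]
    by_cases hk : k < N - m ∨ N ≤ k
    · rw [hr k hk, Finset.sum_eq_zero]
      intro i _
      rw [Finsupp.single_apply, if_neg]
      have := i.isLt
      omega
    · rw [Finset.sum_eq_single (⟨(N - 1 - k).toNat, by omega⟩ : Fin m)]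
      · have : N - ((((N - 1 - k).toNat : ℕ) : ℤ) + 1) = k := by omega
        simp only [this, Finsupp.single_eq_same]
      · intro i _ hi
        rw [Finsupp.single_apply, if_neg]
        intro h
        apply hi
        ext
        simp only
        omega
      · simp
  have hv := Matrix.eq_zero_of_mulVec_eq_zero
    (M := Matrix.of fun l j : Fin m => (R l).eval ((N : ℝ) - ((j : ℕ) + 1))) hN
    (v := fun j : Fin m => r (N - ((j : ℕ) + 1))) (by
      ext h
      have := hphi h
      rw [hrep, map_sum] at this
      simp only [phiF, Finsupp.linearCombination_single, smul_eq_mul] at this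
      simp only [Matrix.mulVec, dotProduct, Matrix.of_apply, Pi.zero_apply]
      rw [← this]
      refine Finset.sum_congr rfl fun j _ => ?_
      push_cast
      ring)
  rw [hrep]
  refine Finset.sum_eq_zero fun j _ => ?_
  have := congrFun hv j
  simp only [Pi.zero_apply] at this
  rw [this, Finsupp.single_zero]

theorem elim {m : ℕ} (R : Fin m → ℝ[X]) (hΩ : ∀ n : ℕ, casoratian R (n : ℝ) ≠ 0) (N : ℕ)
    (t : ℕ) : ∀ f : ℤ →₀ ℝ, (∀ k : ℤ, (N : ℤ) + t ≤ k → f k = 0) →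
    ∃ (a : ℤ → ℝ) (r : ℤ →₀ ℝ), f = ∑ k ∈ Finset.Ico (N : ℤ) (N + t), a k • qhat R k + r ∧
      ∀ k : ℤ, (N : ℤ) ≤ k → r k = 0 := by
  induction t with
  | zero => intro f hf; exact ⟨0, f, by simp, by simpa using hf⟩
  | succ t ih =>
    intro f hf
    have hc : casoratian R (((N + t : ℕ) : ℤ) : ℝ) ≠ 0 := by exact_mod_cast hΩ (N + t)
    set c : ℝ := f ((N + t : ℕ) : ℤ) / casoratian R (((N + t : ℕ) : ℤ) : ℝ) with hcdef
    obtain ⟨a, r, h1, h2⟩ := ih (f - c • qhat R ((N + t : ℕ) : ℤ)) (by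
      intro k hk
      rcases eq_or_lt_of_le hk with h | h
      · rw [← Nat.cast_add] at h
        subst h
        simp only [Finsupp.sub_apply, Finsupp.smul_apply, qhat_top, smul_eq_mul, hcdef]
        field_simp
        simp
      · simp only [Finsupp.sub_apply, Finsupp.smul_apply]
        rw [qhat_supp R _ k (Or.inr (by push_cast; omega)), hf k (by push_cast; omega)]
        simp)
    refine ⟨Function.update a ((N : ℤ) + t) c, r, ?_, h2⟩
    have e : Finset.Ico (N : ℤ) (N + (t + 1 : ℕ)) =
        insert ((N : ℤ) + t) (Finset.Ico (N : ℤ) (N + t)) := by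
      ext k; simp only [Finset.mem_Ico, Finset.mem_insert]; push_cast; omega
    rw [e, Finset.sum_insert (by simp), Function.update_self]
    have e2 : ∑ k ∈ Finset.Ico (N : ℤ) (N + t), Function.update a ((N : ℤ) + t) c k • qhat R k
        = ∑ k ∈ Finset.Ico (N : ℤ) (N + t), a k • qhat R k := by
      refine Finset.sum_congr rfl fun k hk => ?_
      rw [Function.update_of_ne]
      rw [Finset.mem_Ico] at hk; omega
    rw [e2, add_assoc, ← h1]
    push_cast
    abel

theorem le_Gmax {m : ℕ} (g : Fin m → ℕ) (hg : StrictMono g) : m ≤ Gmax g + 1 := by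
  rcases m with _ | m
  · omega
  · have h1 : ∀ i : Fin (m + 1), (i : ℕ) ≤ g i := by
      intro i
      obtain ⟨i, hi⟩ := i
      induction i with
      | zero => simp
      | succ i ih =>
        have := ih (by omega)
        have h2 : g ⟨i, by omega⟩ < g ⟨i + 1, hi⟩ := hg (by simp)
        simp only at *
        omega
    have h2 := h1 (Fin.last m)
    have h3 : g (Fin.last m) ≤ Gmax g := Finset.le_sup (f := g) (Finset.mem_univ _)
    simp at h2
    omega

theorem main_step (α : ℝ) (m : ℕ) (g : Fin m → ℕ) (hg : StrictMono g)
    (R : Fin m → Polynomial ℝ)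
    (hdeg : ∀ i, (R i).natDegree = g i)
    (hα : ∀ k : ℕ, α - (Gmax g : ℝ) ≠ -(k : ℝ))
    (hΩ : ∀ n : ℕ, casoratian R (n : ℝ) ≠ 0)
    (p : Polynomial ℝ) (hp : p ≠ 0) (s : ℕ) (hs : s = p.natDegree + Gmax g + 1) (n : ℕ) :
    ∃ a : ℤ → ℝ,
      X ^ (Gmax g + 1) * p * qZ α R (n : ℤ) =
        ∑ j ∈ Finset.Icc (-(s : ℤ)) (s : ℤ), C (a ((n : ℤ) + j)) * qZ α R ((n : ℤ) + j) ∧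
      a (n + s) ≠ 0 ∧ (s ≤ n → a (n - s) ≠ 0) := by
  set P : ℝ[X] := X ^ (Gmax g + 1) * p with hPdef
  have hP : P ≠ 0 := mul_ne_zero (pow_ne_zero _ X_ne_zero) hp
  have hPd : P.natDegree = s := by
    rw [hPdef, natDegree_mul (pow_ne_zero _ X_ne_zero) hp, natDegree_X_pow]; omega
  set f := aeval (Xhat α) P (qhat R n) with hfdef
  have hphi : ∀ h, phiF (R h) f = 0 := by
    intro h
    rw [hfdef, hPdef, map_mul, Module.End.mul_apply, map_pow, aeval_X]
    refine phi_Xhat_pow α _ _ ?_ _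
    refine degree_le_natDegree.trans_lt (Nat.cast_lt.mpr ?_)
    have h3 : g h ≤ Gmax g := Finset.le_sup (f := g) (Finset.mem_univ _)
    rw [hdeg]; omega
  obtain ⟨hsupp, htop, hbot⟩ := aeval_supp α (qhat R n) (n - m) n (qhat_supp R n) P hP
  rw [hPd, ← hfdef] at hsupp htop hbot
  obtain ⟨a, r, hfr, hr⟩ := elim R hΩ (n - s) (n + s + 1 - (n - s)) f (by
    intro k hk; exact hsupp k (Or.inr (by omega)))
  have hT : ((n - s : ℕ) : ℤ) + ((n + s + 1 - (n - s) : ℕ) : ℤ) = n + s + 1 := by omega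
  rw [hT] at hfr
  have hr0 : s ≤ n → r = 0 := by
    intro hsn
    refine remainder_zero R ((n - s : ℕ) : ℤ) (by exact_mod_cast hΩ (n - s)) r ?_ ?_
    · intro k hk
      rcases hk with hk | hk
      · have h1 := hsupp k (Or.inl (by omega))
        rw [hfr, Finsupp.add_apply, Finsupp.finsetSum_apply, Finset.sum_eq_zero] at h1
        · simpa using h1
        · intro l hl
          rw [Finset.mem_Ico] at hl
          rw [Finsupp.smul_apply, qhat_supp R l k (Or.inl (by omega)), smul_zero]
      · exact hr k hk
    · intro h
      have h1 := hphi h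
      rw [hfr, map_add, map_sum] at h1
      simpa [phi_qhat] using h1
  have hpir : piL α r = 0 := by
    by_cases hsn : s ≤ n
    · rw [hr0 hsn, map_zero]
    · rw [piL, Finsupp.linearCombination_apply, Finsupp.sum]
      refine Finset.sum_eq_zero fun k _ => ?_
      by_cases hk : k < 0
      · simp [laguerreZ, hk]
      · rw [hr k (by omega), zero_smul]
  refine ⟨a, ?_, ?_, ?_⟩
  · have h1 : qZ α R (n : ℤ) = qpoly α R n := by simp [qZ]
    rw [h1, ← piL_qhat, ← piL_aeval, ← hfdef, hfr, map_add, hpir, add_zero, map_sum]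
    have h2 : ∑ j ∈ Finset.Icc (-(s : ℤ)) (s : ℤ), C (a ((n : ℤ) + j)) * qZ α R ((n : ℤ) + j)
        = ∑ k ∈ Finset.Ico ((n : ℤ) - s) (n + s + 1), C (a k) * qZ α R k := by
      refine Finset.sum_nbij' (fun j => (n : ℤ) + j) (fun k => k - n) ?_ ?_ ?_ ?_ ?_
      · intro j hj; simp only [Finset.mem_Icc, Finset.mem_Ico] at *; omega
      · intro j hj; simp only [Finset.mem_Icc, Finset.mem_Ico] at *; omega
      · intro j hj; simp
      · intro j hj; simp
      · intro j hj; rfl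
    rw [h2]
    symm
    rw [← Finset.sum_subset (s₁ := Finset.Ico ((n - s : ℕ) : ℤ) (n + s + 1))]
    · refine Finset.sum_congr rfl fun k hk => ?_
      rw [Finset.mem_Ico] at hk
      rw [map_smul, piL_qhat, smul_eq_C_mul, qZ, if_neg (by omega)]
    · intro k hk; simp only [Finset.mem_Ico] at *; omega
    · intro k hk hk'
      simp only [Finset.mem_Ico] at *
      rw [qZ, if_pos (by omega), mul_zero]
  · have h1 := htop (by omega) (by rw [qhat_top]; exact_mod_cast hΩ n)
    intro ha
    apply h1
    rw [hfr, Finsupp.add_apply, hr _ (by omega), add_zero, Finsupp.finsetSum_apply]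
    refine Finset.sum_eq_zero fun k hk => ?_
    rw [Finset.mem_Ico] at hk
    rcases eq_or_ne k (n + s) with rfl | hne
    · simp [ha]
    · rw [Finsupp.smul_apply, qhat_supp R k _ (Or.inr (by omega)), smul_zero]
  · intro hsn
    have hG := le_Gmax g hg
    have h1 := hbot (by
      intro i hi h0
      refine hα (Gmax g + n - m - i) ?_
      have : ((Gmax g + n - m - i : ℕ) : ℝ) = (Gmax g : ℝ) + n - m - i := by
        rw [Nat.cast_sub (by omega), Nat.cast_sub (by omega)]; push_cast; ring
      rw [this]
      push_cast at h0
      linarith) (by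
      rw [qhat_bot]
      refine mul_ne_zero (by simp) ?_
      exact_mod_cast hΩ (n + 1))
    intro ha
    apply h1
    rw [hfr, hr0 hsn, add_zero, Finsupp.finsetSum_apply]
    refine Finset.sum_eq_zero fun k hk => ?_
    rw [Finset.mem_Ico] at hk
    rcases eq_or_ne k (n - s) with rfl | hne
    · simp [ha]
    · rw [Finsupp.smul_apply, qhat_supp R k _ (Or.inl (by omega)), smul_zero]

/-- higher-order recurrence `x^{max G + 1}·p(x)·q_n = Σ_{j=−s}^{s} γ_{n,j} q_{n+j}`
with `s = deg p + max G + 1`, `γ_{n,s} ≠ 0` for all `n ≥ 0` and `γ_{n,−s} ≠ 0` for `n ≥ s`. -/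
theorem statement0 (α : ℝ) (m : ℕ) (hm : 0 < m) (g : Fin m → ℕ) (hg : StrictMono g)
    (hgpos : ∀ i, 0 < g i) (R : Fin m → Polynomial ℝ)
    (hdeg : ∀ i, (R i).natDegree = g i)
    (hlead : ∀ i, (R i).leadingCoeff = 1 / (Nat.factorial (g i) : ℝ))
    (hα : ∀ k : ℕ, α - (Gmax g : ℝ) ≠ -(k : ℝ))
    (hΩ : ∀ n : ℕ, casoratian R (n : ℝ) ≠ 0)
    (p : Polynomial ℝ) (hp : p ≠ 0) :
    ∃ γ : ℕ → ℤ → ℝ,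
      (∀ n : ℕ,
        Polynomial.X ^ (Gmax g + 1) * p * qZ α R (n : ℤ) =
          ∑ j ∈ Finset.Icc (-((p.natDegree + Gmax g + 1 : ℕ) : ℤ)) ((p.natDegree + Gmax g + 1 : ℕ) : ℤ),
            Polynomial.C (γ n j) * qZ α R ((n : ℤ) + j)) ∧
      (∀ n : ℕ, γ n ((p.natDegree + Gmax g + 1 : ℕ) : ℤ) ≠ 0) ∧
      (∀ n : ℕ, ((p.natDegree + Gmax g + 1 : ℕ) : ℤ) ≤ (n : ℤ) →
        γ n (-((p.natDegree + Gmax g + 1 : ℕ) : ℤ)) ≠ 0) := by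
  choose a h1 h2 h3 using fun n => main_step α m g hg R hdeg hα hΩ p hp _ rfl n
  refine ⟨fun n j => a n ((n : ℤ) + j), h1, h2, ?_⟩
  intro n hn
  exact h3 n (by exact_mod_cast hn)
end

section
/- Let α be a positive integer with α ≤ max G and assume Ω_G(n) ≠ 0 for every integer n ≥ 0. Then, with no assumptions on the real numbers κ_i^g (i = 0,…,m−1, g ∈ G), one has ⟨q_n, x^i⟩_ξ = 0 for every n ≥ m and every 0 ≤ i ≤ n−1, where ⟨·,·⟩_ξ is the bilinear form defined below. -/
open Polynomial Finset

/-- The linear functional on polynomials with `x^j ↦ f j`. -/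
noncomputable def fnl (f : ℕ → ℝ) : ℝ[X] →ₗ[ℝ] ℝ :=
  Polynomial.lsum (fun j => (f j) • (LinearMap.id : ℝ →ₗ[ℝ] ℝ))

lemma fnl_range (f : ℕ → ℝ) (p : ℝ[X]) (N : ℕ) (hN : p.natDegree < N) :
    fnl f p = ∑ t ∈ Finset.range N, p.coeff t * f t := by
  have : fnl f p = p.sum (fun j a => f j * a) := rfl
  rw [this, Polynomial.sum_over_range' p (by simp) N hN]
  exact Finset.sum_congr rfl fun _ _ => mul_comm _ _

lemma fnl_C_mul (f : ℕ → ℝ) (c : ℝ) (p : ℝ[X]) : fnl f (C c * p) = c * fnl f p := by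
  rw [← smul_eq_C_mul, map_smul, smul_eq_mul]

lemma fnl_X_pow (f : ℕ → ℝ) (k : ℕ) : fnl f (X ^ k) = f k := by
  rw [fnl_range f (X ^ k) (k + 1) (by simp)]
  simp [Polynomial.coeff_X_pow]

lemma fnl_mul_X_pow (f : ℕ → ℝ) (p : ℝ[X]) (k : ℕ) :
    fnl f (p * X ^ k) = fnl (fun t => f (t + k)) p := by
  induction p using Polynomial.induction_on' with
  | add p q hp hq => rw [add_mul, map_add, map_add, hp, hq]
  | monomial n a =>
    rw [← C_mul_X_pow_eq_monomial, mul_assoc, ← pow_add, fnl_C_mul, fnl_C_mul, fnl_X_pow, fnl_X_pow]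

lemma fnl_const_mul (f : ℕ → ℝ) (c : ℝ) (p : ℝ[X]) :
    fnl (fun t => c * f t) p = c * fnl f p := by
  rw [fnl_range _ p _ (Nat.lt_succ_self _), fnl_range _ p _ (Nat.lt_succ_self _), Finset.mul_sum]
  exact Finset.sum_congr rfl fun _ _ => by ring

lemma momFun_eq (β : ℝ) (p : ℝ[X]) (k : ℤ) :
    momFun β p k = fnl (fun t => Real.Gamma (β + t + k + 1)) p := by
  rw [fnl_range _ p _ (Nat.lt_succ_self _)]; rfl

lemma poch_succ (x : ℝ) (t : ℕ) : poch x (t + 1) = poch x t * (x + t) := by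
  simp [poch, Finset.prod_range_succ]

lemma gamma_poch (x : ℝ) (hx : 0 < x) (t : ℕ) :
    Real.Gamma (x + t) = Real.Gamma x * poch x t := by
  induction t with
  | zero => simp [poch]
  | succ t ih =>
    rw [poch_succ, ← mul_assoc, ← ih]
    push_cast
    rw [← add_assoc, Real.Gamma_add_one (by positivity)]
    ring

lemma momFun_poch (β : ℝ) (p : ℝ[X]) (k : ℤ) (h : 0 < β + k + 1) :
    momFun β p k = Real.Gamma (β + k + 1) * fnl (poch (β + k + 1)) p := by
  rw [momFun_eq, ← fnl_const_mul]
  congr 2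
  funext t
  rw [← gamma_poch _ h]
  congr 1; ring

lemma choose_prod (a : ℝ) (n : ℕ) :
    Ring.choose a n = (∏ t ∈ Finset.range n, (a - t)) / (Nat.factorial n : ℝ) := by
  rw [Ring.choose_eq_smul, smul_eq_mul, div_eq_inv_mul]
  congr 1
  induction n with
  | zero => simp
  | succ n ih =>
    rw [descPochhammer_succ_right, Polynomial.smeval_mul, ih, Finset.prod_range_succ]
    congr 1
    rw [Polynomial.smeval_sub, Polynomial.smeval_X, Polynomial.smeval_natCast]
    simp

lemma fnl_laguerre (f : ℕ → ℝ) (a : ℝ) (k : ℕ) :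
    fnl f (laguerre a k) = ∑ j ∈ Finset.range (k + 1),
      ((-1 : ℝ) ^ j / (Nat.factorial j : ℝ) * genBinom a k j) * f j := by
  rw [laguerre, map_sum]
  exact Finset.sum_congr rfl fun _ _ => by rw [fnl_C_mul, fnl_X_pow]

lemma key (a b : ℝ) (k : ℕ) :
    fnl (poch (a - b)) (laguerre a k) = poch (b + 1) k / (Nat.factorial k : ℝ) := by
  have h := Ring.add_choose_eq (r := b - a) (s := (k : ℝ) + a) k (Commute.all _ _)
  rw [Finset.Nat.sum_antidiagonal_eq_sum_range_succ (fun i j =>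
    Ring.choose (b - a) i * Ring.choose ((k : ℝ) + a) j)] at h
  rw [fnl_laguerre]
  have h2 : Ring.choose (b - a + (k + a)) k = poch (b + 1) k / (Nat.factorial k : ℝ) := by
    rw [choose_prod, poch, ← Finset.prod_range_reflect]
    congr 1
    apply Finset.prod_congr rfl
    intro j hj
    have hj := Finset.mem_range.1 hj
    rw [Nat.sub_sub, Nat.cast_sub (by omega)]
    push_cast; ring
  rw [← h2, h]
  apply Finset.sum_congr rfl
  intro j hj
  have hj := Finset.mem_range.1 hj
  have e1 : Ring.choose (b - a) j = (-1 : ℝ) ^ j / (Nat.factorial j : ℝ) * poch (a - b) j := by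
    rw [choose_prod, poch, div_mul_eq_mul_div]
    congr 1
    have hc : (-1 : ℝ) ^ j = ∏ _t ∈ Finset.range j, (-1 : ℝ) := by simp
    rw [hc, ← Finset.prod_mul_distrib]
    exact Finset.prod_congr rfl fun _ _ => by ring
  have e2 : Ring.choose ((k : ℝ) + a) (k - j) = genBinom a k j := by
    rw [choose_prod, genBinom, Finset.prod_Ico_eq_prod_range, show k + 1 - (j + 1) = k - j by omega,
      ← Finset.prod_range_reflect]
    congr 1
    apply Finset.prod_congr rfl
    intro t ht
    have ht := Finset.mem_range.1 ht
    rw [Nat.sub_sub, Nat.cast_sub (by omega), Nat.cast_sub (by omega)]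
    push_cast; ring
  rw [e1, e2]; ring

lemma key_nat (a : ℝ) (l k : ℕ) :
    fnl (poch (a - l)) (laguerre a k) = (binomPoly l).eval (k : ℝ) := by
  have hp : ∀ u v : ℕ, poch ((u : ℝ) + 1) v * (Nat.factorial u : ℝ) = (Nat.factorial (u + v) : ℝ) := by
    intro u v
    induction v with
    | zero => simp [poch]
    | succ v ih =>
      rw [poch_succ, ← add_assoc, Nat.factorial_succ, Nat.cast_mul, ← ih]
      push_cast; ring
  have h1 := hp l k
  have h2 := hp k l
  have e : (binomPoly l).eval (k : ℝ) = poch ((k : ℝ) + 1) l / (Nat.factorial l : ℝ) := by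
    rw [binomPoly, eval_mul, eval_C, eval_prod, poch, div_eq_inv_mul]
    congr 1
    exact Finset.prod_congr rfl fun _ _ => by simp; ring
  rw [key, e, div_eq_div_iff (by positivity) (by positivity), h1, h2, add_comm]

lemma key_neg (a : ℝ) (s k : ℕ) (hs : s < k) :
    fnl (poch (a + s + 1)) (laguerre a k) = 0 := by
  have h := key a (-(s : ℝ) - 1) k
  rw [show a - (-(s : ℝ) - 1) = a + s + 1 by ring] at h
  rw [h, poch, Finset.prod_eq_zero (Finset.mem_range.2 hs) (by ring), zero_div]

/-- Real matrix with first row `v` and the rows of values of the polynomials R. -/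
noncomputable def cmat {m : ℕ} (R : Fin m → ℝ[X]) (n : ℤ) (v : ℕ → ℝ) :
    Matrix (Fin (m + 1)) (Fin (m + 1)) ℝ :=
  Matrix.of fun i j : Fin (m + 1) =>
    if h : (i : ℕ) = 0 then v j
    else ((R ⟨(i : ℕ) - 1, by have := i.isLt; omega⟩).eval ((n : ℝ) - ((j : ℕ) : ℝ)))

lemma fnl_qpoly (f : ℕ → ℝ) (α : ℝ) {m : ℕ} (R : Fin m → ℝ[X]) (n : ℕ) (hn : m ≤ n) :
    fnl f (qpoly α R n) = (cmat R n (fun j => fnl f (laguerre α (n - j)))).det := by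
  rw [qpoly, Matrix.det_succ_row_zero, Matrix.det_succ_row_zero, map_sum]
  apply Finset.sum_congr rfl
  intro j _
  have hj : (j : ℕ) ≤ n := by have := j.isLt; omega
  have e1 : laguerreZ α ((n : ℤ) - (j : ℕ)) = laguerre α (n - j) := by
    rw [laguerreZ, if_neg (by omega)]
    congr 1; omega
  set D := ((cmat R n (fun j => fnl f (laguerre α (n - j)))).submatrix Fin.succ j.succAbove).det
    with hD
  have e2 : ((Matrix.of fun i j : Fin (m + 1) =>
    if h : (i : ℕ) = 0 then laguerreZ α ((n : ℤ) - (j : ℕ))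
    else Polynomial.C ((R ⟨(i : ℕ) - 1, by have := i.isLt; omega⟩).eval
      (((n : ℤ) : ℝ) - ((j : ℕ) : ℝ)))).submatrix Fin.succ j.succAbove).det = C D := by
    rw [hD, RingHom.map_det]
    congr 1
  rw [e2]
  have e3 : cmat R n (fun j => fnl f (laguerre α (n - j))) 0 j = fnl f (laguerre α (n - j)) := by
    simp [cmat]
  rw [e3, Matrix.of_apply, dif_pos (by simp), e1]
  rw [show (-1 : ℝ[X]) ^ (j : ℕ) * laguerre α (n - j) * C D
    = C ((-1) ^ (j : ℕ) * D) * laguerre α (n - j) by simp; ring, fnl_C_mul]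
  ring

lemma coeff_of_deriv (p : ℝ[X]) (j : ℕ) :
    Polynomial.eval 0 (Polynomial.derivative^[j] p) / (Nat.factorial j : ℝ) = p.coeff j := by
  rw [← coeff_zero_eq_eval_zero, coeff_iterate_derivative, zero_add, Nat.descFactorial_self,
    nsmul_eq_mul]
  field_simp

lemma poch_zero_of (x : ℝ) (d t : ℕ) (hx : x = -(d : ℝ)) (h : d < t) : poch x t = 0 := by
  rw [poch, Finset.prod_eq_zero (Finset.mem_range.2 h) (by rw [hx]; ring)]

lemma fnl_trunc (x : ℝ) (d : ℕ) (hx : x = -(d : ℝ)) (p : ℝ[X]) :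
    fnl (poch x) p = ∑ j ∈ Finset.range (d + 1), p.coeff j * poch x j := by
  rw [fnl_range _ p (p.natDegree + 1 + (d + 1)) (by omega)]
  symm
  apply Finset.sum_subset
  · intro t; simp only [Finset.mem_range]; omega
  · intro t _ ht
    rw [poch_zero_of x d t hx (by simpa using ht), mul_zero]

lemma term_small (α l : ℕ) (h : l < α) (p : ℝ[X]) :
    poch ((α : ℝ) - l) l * momFun α p (-((l : ℤ) + 1)) =
      Real.Gamma α * fnl (poch ((α : ℝ) - l)) p := by
  have h' : (l : ℝ) < α := by exact_mod_cast h
  have e : (α : ℝ) + ((-((l : ℤ) + 1) : ℤ) : ℝ) + 1 = α - l := by push_cast; ring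
  have h3 := gamma_poch ((α : ℝ) - l) (by linarith) l
  rw [momFun_poch _ _ _ (by rw [e]; linarith), e]
  rw [sub_add_cancel] at h3
  rw [h3]; ring

lemma Fh (α G : ℕ) (w : ℕ → ℝ) (p : ℝ[X]) :
    (∑ l ∈ Finset.range (if G < α then G + 1 else α),
      poch ((α : ℝ) - l) l * w l * momFun α p (-((l : ℤ) + 1))) +
    Real.Gamma α * (if α ≤ G then ∑ j ∈ Finset.range (G - α + 1), p.coeff j *
      ∑ l ∈ Finset.Icc (α + j) G, poch ((α : ℝ) - l) j * w l else 0) =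
    Real.Gamma α * ∑ l ∈ Finset.range (G + 1), w l * fnl (poch ((α : ℝ) - l)) p := by
  have small : ∀ N, N ≤ α → ∑ l ∈ Finset.range N,
      poch ((α : ℝ) - l) l * w l * momFun α p (-((l : ℤ) + 1)) =
      Real.Gamma α * ∑ l ∈ Finset.range N, w l * fnl (poch ((α : ℝ) - l)) p := by
    intro N hN
    rw [Finset.mul_sum]
    apply Finset.sum_congr rfl
    intro l hl
    have := term_small α l (by have := Finset.mem_range.1 hl; omega) p
    linear_combination w l * this
  by_cases h : G < α
  · rw [if_pos h, if_neg (by omega), mul_zero, add_zero, small _ (by omega)]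
  · rw [if_neg h, if_pos (by omega), small _ le_rfl, ← mul_add]
    congr 1
    rw [← Finset.sum_range_add_sum_Ico _ (show α ≤ G + 1 by omega)]
    congr 1
    simp only [Finset.mul_sum]
    rw [Finset.sum_comm' (t' := Finset.Ico α (G + 1)) (s' := fun l => Finset.range (l - α + 1))]
    · apply Finset.sum_congr rfl
      intro l hl
      have hl := Finset.mem_Ico.1 hl
      rw [fnl_trunc ((α : ℝ) - l) (l - α) (by rw [Nat.cast_sub hl.1]; ring), Finset.mul_sum]
      exact Finset.sum_congr rfl fun _ _ => by ring
    · intro x y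
      simp only [Finset.mem_range, Finset.mem_Icc, Finset.mem_Ico]
      omega

lemma Fh_zero (α : ℕ) {m : ℕ} (g : Fin m → ℕ) (R : Fin m → ℝ[X]) (w : Fin m → ℕ → ℝ)
    (hw : ∀ h : Fin m, R h = ∑ l ∈ Finset.range (g h + 1), Polynomial.C (w h l) * binomPoly l)
    (n : ℕ) (hn : m ≤ n) (h : Fin m) :
    ∑ l ∈ Finset.range (g h + 1), w h l * fnl (poch ((α : ℝ) - l)) (qpoly (α : ℝ) R n) = 0 := by
  set f : ℕ → ℝ := fun t => ∑ l ∈ Finset.range (g h + 1), w h l * poch ((α : ℝ) - l) t with hf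
  have hfn : ∀ p : ℝ[X], fnl f p =
      ∑ l ∈ Finset.range (g h + 1), w h l * fnl (poch ((α : ℝ) - l)) p := by
    intro p
    rw [fnl_range _ p _ (Nat.lt_succ_self _)]
    simp only [hf, Finset.mul_sum, fnl_range _ p _ (Nat.lt_succ_self _)]
    rw [Finset.sum_comm]
    exact Finset.sum_congr rfl fun _ _ => Finset.sum_congr rfl fun _ _ => by ring
  rw [← hfn, fnl_qpoly f _ R n hn]
  apply Matrix.det_zero_of_row_eq (i := 0) (j := h.succ) (Fin.succ_ne_zero h).symm
  funext j
  have hj : (j : ℕ) ≤ n := by have := j.isLt; omega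
  simp only [cmat, Matrix.of_apply, Fin.val_zero, dif_pos, Fin.val_succ, Nat.add_sub_cancel,
    Nat.succ_ne_zero, dif_neg, not_false_eq_true, Fin.eta]
  rw [hfn, hw h, eval_finsetSum]
  apply Finset.sum_congr rfl
  intro l _
  rw [key_nat, eval_mul, eval_C, Nat.cast_sub hj]
  simp

lemma mom_orth (α : ℕ) {m : ℕ} (R : Fin m → ℝ[X]) (n : ℕ) (s : ℕ) (hs : s + m < n) :
    momFun α (qpoly (α : ℝ) R n) s = 0 := by
  rw [momFun_poch _ _ _ (by push_cast; positivity), fnl_qpoly _ _ R n (by omega)]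
  rw [Matrix.det_eq_zero_of_row_eq_zero 0, mul_zero]
  intro j
  have := j.isLt
  simp only [cmat, Matrix.of_apply, Fin.val_zero, dif_pos]
  exact_mod_cast key_neg (α : ℝ) s (n - j) (by omega)

lemma first_term (α m i : ℕ) (p : ℝ[X]) :
    momFun ((α - m : ℕ) : ℝ) (p * Polynomial.derivative^[m - α] (X ^ i)) 0 =
      poch ((i : ℝ) - m + α + 1) (m - α) * momFun α p ((i : ℤ) - (m : ℤ)) := by
  rw [iterate_derivative_X_pow_eq_C_mul, mul_left_comm, momFun_eq, fnl_C_mul, fnl_mul_X_pow,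
    momFun_eq]
  by_cases h : i < m - α
  · rw [Nat.descFactorial_of_lt h, poch_zero_of _ (m - α - 1 - i) _ ?_ (by omega)]
    · simp
    · rw [Nat.cast_sub (by omega), Nat.cast_sub (by omega), Nat.cast_sub (by omega)]
      push_cast; ring
  · push Not at h
    congr 1
    · rw [Nat.descFactorial_eq_prod_range, poch, ← Finset.prod_range_reflect]
      push_cast
      apply Finset.prod_congr rfl
      intro t ht
      have ht := Finset.mem_range.1 ht
      rw [Nat.sub_sub, Nat.cast_sub (by omega), Nat.cast_sub (by omega), Nat.cast_sub (by omega)]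
      push_cast; ring
    · congr 2
      funext t
      congr 1
      rcases le_total m α with hm | hm
      · rw [Nat.cast_sub hm, Nat.sub_eq_zero_of_le hm, Nat.sub_zero]
        push_cast; ring
      · rw [Nat.sub_eq_zero_of_le hm]
        push_cast [Nat.cast_sub h, Nat.cast_sub hm]; ring

/-- for a positive integer `α ≤ max G` and with no assumptions on the numbers
`κ_i^g`, one has `⟨q_n, x^i⟩_ξ = 0` for every `n ≥ m` and `0 ≤ i ≤ n−1`. -/
theorem statement9 (α : ℕ) (hα : 0 < α) (m : ℕ) (hm : 0 < m) (g : Fin m → ℕ)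
    (hg : StrictMono g) (hgpos : ∀ i, 0 < g i) (hαG : α ≤ Gmax g)
    (R : Fin m → Polynomial ℝ)
    (hdeg : ∀ i, (R i).natDegree = g i)
    (hlead : ∀ i, (R i).leadingCoeff = 1 / (Nat.factorial (g i) : ℝ))
    (hΩ : ∀ n : ℕ, casoratian R (n : ℝ) ≠ 0)
    (w : Fin m → ℕ → ℝ)
    (hw : ∀ h : Fin m, R h = ∑ l ∈ Finset.range (g h + 1), Polynomial.C (w h l) * binomPoly l)
    (κ : ℕ → Fin m → ℝ) :
    ∀ n : ℕ, m ≤ n → ∀ i : ℕ, i < n →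
      bilinXi α g κ w (qpoly (α : ℝ) R (n : ℤ)) (Polynomial.X ^ i) = 0 := by
  intro n hn i hi
  simp only [bilinXi, coeff_of_deriv, coeff_X_pow, first_term, ite_mul, one_mul, zero_mul,
    Finset.sum_ite_eq', Finset.mem_range]
  by_cases him : i < m
  · simp only [him, if_true]
    set p := qpoly (α : ℝ) R (n : ℤ) with hp
    have hF : ∀ h : Fin m, _ := fun h => Fh α (g h) (w h) p
    simp only [hp, Fh_zero α g R w hw n hn, mul_zero] at hF
    simp only [← hp] at hF
    have hneg : ∀ h : Fin m, Real.Gamma α * (if α ≤ g h then κ i h *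
        ∑ j ∈ Finset.range (g h - α + 1), p.coeff j *
          ∑ l ∈ Finset.Icc (α + j) (g h), poch ((α : ℝ) - l) j * w h l else 0) =
        -(κ i h * ∑ l ∈ Finset.range (if g h < α then g h + 1 else α),
          poch ((α : ℝ) - l) l * w h l * momFun α p (-((l : ℤ) + 1))) := by
      intro h
      have := hF h
      by_cases h2 : α ≤ g h
      · rw [if_pos h2] at this ⊢
        linear_combination κ i h * this
      · rw [if_neg h2] at this ⊢
        linear_combination κ i h * this
    rw [Finset.sum_filter, Finset.sum_add_distrib, Finset.mul_sum]
    simp only [hneg]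
    rw [Finset.sum_neg_distrib, Finset.sum_const, Finset.card_univ, Fintype.card_fin, nsmul_eq_mul]
    have : (m : ℝ) ≠ 0 := by positivity
    field_simp
    ring
  · simp only [him, if_false, mul_zero, add_zero]
    have := mom_orth α R n (i - m) (by omega)
    rw [Nat.cast_sub (by omega)] at this
    rw [this, mul_zero]
end
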